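/- Assume MA(ω₁). Then for every Aronszajn tree T there exists an Aronszajn tree T* such that there is no weak embedding from T* into T. -/

import Mathlib

universe u

open Cardinal Ordinal Set Classical

noncomputable def omega1 : Ordinal.{u} := (Cardinal.aleph 1).ord

/-- A tree: a partial order in which the set of strict predecessors of each element
is well-ordered by `<`. -/
def IsTree (T : Type u) [PartialOrder T] : Prop :=
  ∀ x : T, IsWellOrder {y : T // y < x} (fun a b => (a : T) < (b : T))

/-- The height of an element of a tree: the order type of its set of strict predecessors. -/
noncomputable def treeHeight {T : Type u} [PartialOrder T] (x : T) : Ordinal.{u} :=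
  if h : IsWellOrder {y : T // y < x} (fun a b => (a : T) < (b : T)) then
    @Ordinal.type _ _ h else 0

/-- The tree has height `ω₁`: every level below `ω₁` is nonempty and the level `ω₁` is empty
(equivalently, all heights are `< ω₁`). -/
def HasHeightOmega1 (T : Type u) [PartialOrder T] : Prop :=
  (∀ α : Ordinal.{u}, α < omega1.{u} → ∃ x : T, treeHeight x = α) ∧
    ∀ x : T, treeHeight x < omega1.{u}

def NoUncountableChain (T : Type u) [PartialOrder T] : Prop :=
  ∀ C : Set T, IsChain (· < ·) C → C.Countable

def IsWideAronszajn (T : Type u) [PartialOrder T] : Prop :=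
  IsTree T ∧ Cardinal.mk T = Cardinal.aleph.{u} 1 ∧ HasHeightOmega1 T ∧ NoUncountableChain T

def IsAronszajn (T : Type u) [PartialOrder T] : Prop :=
  IsTree T ∧ HasHeightOmega1 T ∧
    (∀ α : Ordinal.{u}, {x : T | treeHeight x = α}.Countable) ∧ NoUncountableChain T

def IsWeakEmbedding {T₁ T₂ : Type u} [PartialOrder T₁] [PartialOrder T₂] (f : T₁ → T₂) : Prop :=
  ∀ x y : T₁, x < y → f x < f y

/-- Martin's axiom for ℵ₁ many dense sets. -/
def MAomega1 : Prop :=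
  ∀ (P : Type u) [PartialOrder P], Nonempty P →
    (∀ A : Set P, (A.Pairwise fun p q => ¬ ∃ r, p ≤ r ∧ q ≤ r) → A.Countable) →
    ∀ 𝒟 : Set (Set P), Cardinal.mk 𝒟 ≤ Cardinal.aleph.{u} 1 →
      (∀ D ∈ 𝒟, ∀ p : P, ∃ q ∈ D, p ≤ q) →
      ∃ G : Set P, (∀ p ∈ G, ∀ q ∈ G, ∃ r ∈ G, p ≤ r ∧ q ≤ r) ∧
        (∀ p ∈ G, ∀ q, q ≤ p → q ∈ G) ∧ ∀ D ∈ 𝒟, (G ∩ D).Nonempty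

/-- A bundled partially ordered type. -/
structure PoType : Type (u + 1) where
  carrier : Type u
  str : PartialOrder carrier

attribute [instance] PoType.str


/-! ### Uncountable sets -/

theorem exists_not_countable_fiber {α : Type*} {β : Type*} [Countable β] (f : α → β) {A : Set α}
    (hA : ¬ A.Countable) : ∃ b, ¬ {a ∈ A | f a = b}.Countable := by
  by_contra! h
  refine hA ((countable_iUnion h).mono ?_)
  intro a ha
  exact mem_iUnion.2 ⟨f a, ha, rfl⟩

/-- A weak form of the Δ-system lemma: an uncountable family of finite sets has an uncountable
subfamily with a root `R` such that every point outside `R` lies in only countably many members. -/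
theorem exists_root {P T : Type*} (K : P → Finset T) {A : Set P} (hA : ¬ A.Countable) :
    ∃ B ⊆ A, ¬ B.Countable ∧ ∃ R : Finset T, (∀ q ∈ B, R ⊆ K q) ∧
      ∀ x ∉ R, {q ∈ B | x ∈ K q}.Countable := by
  obtain ⟨n, hn⟩ := exists_not_countable_fiber (fun p => (K p).card) hA
  have key : ∀ m : ℕ, ∀ R : Finset T, n ≤ R.card + m →
      ¬ {q ∈ A | (K q).card = n ∧ R ⊆ K q}.Countable →
      ∃ B ⊆ A, ¬ B.Countable ∧ ∃ R : Finset T, (∀ q ∈ B, R ⊆ K q) ∧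
        ∀ x ∉ R, {q ∈ B | x ∈ K q}.Countable := by
    intro m
    induction m with
    | zero =>
      intro R hR hc
      refine ⟨_, fun q hq => hq.1, hc, R, fun q hq => hq.2.2, fun x hx => ?_⟩
      convert countable_empty
      ext q
      simp only [mem_ofPred_eq, mem_empty_iff_false, iff_false]
      rintro ⟨⟨-, h1, h2⟩, h3⟩
      have := Finset.card_le_card (Finset.insert_subset h3 h2)
      rw [Finset.card_insert_of_notMem hx] at this
      omega
    | succ m ih =>
      intro R hR hc
      by_cases h : ∀ x ∉ R, {q ∈ {q ∈ A | (K q).card = n ∧ R ⊆ K q} | x ∈ K q}.Countable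
      · exact ⟨_, fun q hq => hq.1, hc, R, fun q hq => hq.2.2, h⟩
      · push Not at h
        obtain ⟨x, hx, hxc⟩ := h
        refine ih (insert x R) (by rw [Finset.card_insert_of_notMem hx]; omega) fun h' => hxc ?_
        refine h'.mono ?_
        rintro q ⟨⟨h1, h2, h3⟩, h4⟩
        exact ⟨h1, h2, Finset.insert_subset h4 h3⟩
  refine key n ∅ (by simp) fun h => hn (h.mono ?_)
  rintro q ⟨h1, h2⟩
  exact ⟨h1, h2, by simp⟩

/-- In a tree without uncountable chains, among uncountably many pairs of finite sets `S p`, `F p`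
with essentially disjoint `S p`, some `p` is such that for uncountably many `q` no element of `S p`
lies below an element of `F q`. -/
theorem exists_eventually_not_lt {P T : Type u} [PartialOrder T]
    (hchain : NoUncountableChain T)
    (htot : ∀ t x y : T, x < t → y < t → x < y ∨ x = y ∨ y < x)
    (S F : P → Finset T) {A : Set P} (hA : ¬ A.Countable)
    (hS : ∀ x, {p ∈ A | x ∈ S p}.Countable) :
    ∃ p ∈ A, ¬ {q ∈ A | ¬ ∃ x ∈ S p, ∃ s ∈ F q, x < s}.Countable := by
  obtain ⟨k, hk⟩ := exists_not_countable_fiber (fun p => (F p).card) hA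
  set B := {a ∈ A | (F a).card = k} with hB
  by_contra! hcon
  have hne : (Filter.cocountable ⊓ Filter.principal B : Filter P).NeBot := by
    rw [Filter.inf_principal_neBot_iff]
    intro U hU
    rw [Filter.mem_cocountable] at hU
    by_contra h
    rw [not_nonempty_iff_eq_empty] at h
    refine hk (hU.mono ?_)
    intro x hx hxU
    have : x ∈ U ∩ B := ⟨hxU, hx⟩
    rw [h] at this
    exact this
  let U : Ultrafilter P := Ultrafilter.of (Filter.cocountable ⊓ Filter.principal B)
  have hUB : ∀ᶠ q in U, q ∈ B :=
    Ultrafilter.of_le _ (Filter.mem_inf_of_right (Filter.mem_principal_self B))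
  have hUc : ∀ C : Set P, C.Countable → Cᶜ ∈ U := fun C hC =>
    Ultrafilter.of_le _ (Filter.mem_inf_of_left (Filter.mem_cocountable.2 (by simpa using hC)))
  have hex : ∀ p ∈ B, ∃ i : Fin k, ∃ x ∈ S p,
      ∀ᶠ q in U, ∃ h : (F q).card = k, x < ((F q).equivFinOfCardEq h).symm i := by
    intro p hp
    have h1 : ∀ᶠ q in U, ∃ i : Fin k, ∃ x ∈ S p,
        ∃ h : (F q).card = k, x < ((F q).equivFinOfCardEq h).symm i := by
      filter_upwards [hUB, hUc _ (hcon p hp.1)] with q hq hq'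
      obtain ⟨x, hx, s, hs, hxs⟩ : ∃ x ∈ S p, ∃ s ∈ F q, x < s := by
        by_contra! h
        exact hq' ⟨hq.1, h⟩
      exact ⟨(F q).equivFinOfCardEq hq.2 ⟨s, hs⟩, x, hx, hq.2, by simpa using hxs⟩
    rw [Ultrafilter.eventually_exists_iff] at h1
    obtain ⟨i, hi⟩ := h1
    have h2 : ∀ᶠ q in U, ∃ x : S p,
        ∃ h : (F q).card = k, (x : T) < ((F q).equivFinOfCardEq h).symm i := by
      filter_upwards [hi] with q ⟨x, hx, h⟩ using ⟨⟨x, hx⟩, h⟩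
    rw [Ultrafilter.eventually_exists_iff] at h2
    obtain ⟨x, hx⟩ := h2
    exact ⟨i, x, x.2, hx⟩
  choose i x hxS hx using hex
  obtain ⟨j, hj⟩ := exists_not_countable_fiber
    (fun p => if h : p ∈ B then some (i p h) else none) hk
  have hch : IsChain (· < ·) {y | ∃ p, ∃ h : p ∈ B, some (i p h) = j ∧ x p h = y} := by
    rintro _ ⟨p, hp, hpj, rfl⟩ _ ⟨p', hp', hpj', rfl⟩ hne'
    have hii : i p hp = i p' hp' := by
      rw [← hpj] at hpj'
      exact (Option.some_injective _ hpj').symm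
    obtain ⟨q, ⟨h1, hq1⟩, ⟨h2, hq2⟩⟩ := ((hx p hp).and (hx p' hp')).exists
    rw [← hii] at hq2
    rcases htot _ _ _ hq1 hq2 with h | h | h
    · exact Or.inl h
    · exact absurd h hne'
    · exact Or.inr h
  refine hj (((hchain _ hch).biUnion fun y _ => hS y).mono ?_)
  rintro p ⟨hp, hpj⟩
  rw [dif_pos hp] at hpj
  exact mem_biUnion ⟨p, hp, hpj, rfl⟩ ⟨hp.1, hxS p hp⟩

/-! ### The forcing notion -/

/-- A strictly monotone map to a linear order whose fibres behave like the levels of a tree. -/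
structure IsLevelMap {T W : Type*} [PartialOrder T] [LinearOrder W] (r : T → W) : Prop where
  strictMono : StrictMono r
  exists_lt : ∀ t, ∀ w < r t, ∃ x < t, r x = w
  le_of_le : ∀ t x y, x < t → y < t → r x ≤ r y → x ≤ y

theorem IsLevelMap.eq_of_eq {T W : Type*} [PartialOrder T] [LinearOrder W] {r : T → W}
    (hr : IsLevelMap r) {t x y : T} (hx : x < t) (hy : y < t) (h : r x = r y) : x = y :=
  le_antisymm (hr.le_of_le t x y hx hy h.le) (hr.le_of_le t y x hy hx h.ge)

theorem IsLevelMap.lt_trichotomy {T W : Type*} [PartialOrder T] [LinearOrder W] {r : T → W}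
    (hr : IsLevelMap r) (t x y : T) (hx : x < t) (hy : y < t) : x < y ∨ x = y ∨ y < x := by
  rcases le_total (r x) (r y) with h | h
  · rcases (hr.le_of_le t x y hx hy h).lt_or_eq with h | h <;> simp [h]
  · rcases (hr.le_of_le t y x hy hx h).lt_or_eq with h | h <;> simp [h]

/-- A finite approximation to a coherent colouring of a tree. A point is coloured when its value
is nonzero. Below points of `side`, new colours are at least `bound` and are given to whole levels
at once. -/
@[ext]
structure ColoringCond {T W : Type*} (r : T → W) where
  value : T →₀ ℕ
  side : Finset T
  bound : ℕ

namespace ColoringCond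

variable {T W : Type*} [PartialOrder T] {r : T → W}

instance : PartialOrder (ColoringCond r) where
  le p q := p.side ⊆ q.side ∧ p.bound ≤ q.bound ∧
    (∀ x, p.value x ≠ 0 → q.value x = p.value x) ∧
    ∀ s ∈ p.side, ∀ x < s, p.value x = 0 → q.value x ≠ 0 →
      p.bound ≤ q.value x ∧ ∀ t ∈ p.side, ∀ y < t, r x = r y → q.value y = q.value x
  le_refl p := ⟨subset_rfl, le_rfl, fun _ _ => rfl, fun _ _ _ _ h h' => absurd h h'⟩
  le_trans := by
    rintro p q u ⟨h1, h2, h3, h4⟩ ⟨k1, k2, k3, k4⟩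
    refine ⟨h1.trans k1, h2.trans k2, fun x hx => ?_, fun s hs x hxs hp hu => ?_⟩
    · rw [k3 x (by rwa [h3 x hx]), h3 x hx]
    · by_cases hq : q.value x = 0
      · obtain ⟨l1, l2⟩ := k4 s (h1 hs) x hxs hq hu
        exact ⟨h2.trans l1, fun t ht => l2 t (h1 ht)⟩
      · obtain ⟨l1, l2⟩ := h4 s hs x hxs hp hq
        rw [k3 x hq]
        refine ⟨l1, fun t ht y hy hxy => ?_⟩
        have := l2 t ht y hy hxy
        rw [k3 y (by rwa [this]), this]
  le_antisymm := by
    rintro p q ⟨h1, h2, h3, -⟩ ⟨k1, k2, k3, -⟩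
    refine ColoringCond.ext (Finsupp.ext fun x => ?_) (h1.antisymm k1) (h2.antisymm k2)
    by_cases hp : p.value x = 0
    · by_cases hq : q.value x = 0
      · rw [hp, hq]
      · exact k3 x hq
    · exact (h3 x hp).symm

theorem le_def {p q : ColoringCond r} : p ≤ q ↔ p.side ⊆ q.side ∧ p.bound ≤ q.bound ∧
    (∀ x, p.value x ≠ 0 → q.value x = p.value x) ∧
    ∀ s ∈ p.side, ∀ x < s, p.value x = 0 → q.value x ≠ 0 →
      p.bound ≤ q.value x ∧ ∀ t ∈ p.side, ∀ y < t, r x = r y → q.value y = q.value x :=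
  Iff.rfl

theorem value_eq_of_le {p q : ColoringCond r} (h : p ≤ q) {x : T} (hx : p.value x ≠ 0) :
    q.value x = p.value x :=
  h.2.2.1 x hx

theorem exists_upper_bound {p q : ColoringCond r}
    (hpq : ∀ x, p.value x ≠ 0 → q.value x ≠ 0 → p.value x = q.value x)
    (hp : ∀ s ∈ p.side, ∀ x < s, q.value x ≠ 0 → p.value x ≠ 0)
    (hq : ∀ s ∈ q.side, ∀ x < s, p.value x ≠ 0 → q.value x ≠ 0) :
    ∃ u, p ≤ u ∧ q ≤ u := by
  let u : ColoringCond r :=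
    ⟨Finsupp.zipWith max (by simp) p.value q.value, p.side ∪ q.side, max p.bound q.bound⟩
  have hu : ∀ x, u.value x = max (p.value x) (q.value x) := fun x => Finsupp.zipWith_apply (hf := by simp) ..
  refine ⟨u, le_def.2 ⟨Finset.subset_union_left, le_max_left _ _, fun x hx => ?_,
    fun s hs x hxs h0 h1 => ?_⟩, le_def.2 ⟨Finset.subset_union_right, le_max_right _ _,
    fun x hx => ?_, fun s hs x hxs h0 h1 => ?_⟩⟩
  · have := hpq x hx
    rw [hu]
    omega
  · rw [hu] at h1
    exact absurd h0 (hp s hs x hxs (by omega))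
  · have := fun h => hpq x h hx
    rw [hu]
    omega
  · rw [hu] at h1
    exact absurd h0 (hq s hs x hxs (by omega))

end ColoringCond

theorem ColoringCond.countable_of_pairwise {T : Type u} [PartialOrder T] {W : Type u}
    {r : T → W} (hchain : NoUncountableChain T)
    (htot : ∀ t x y : T, x < t → y < t → x < y ∨ x = y ∨ y < x)
    (hIio : ∀ t : T, (Iio t).Countable) (A : Set (ColoringCond r))
    (hA : A.Pairwise fun p q => ¬ ∃ u, p ≤ u ∧ q ≤ u) : A.Countable := by
  by_contra hAc
  obtain ⟨B₀, hB₀, hB₀c, R, hR, hRc⟩ :=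
    exists_root (fun p : ColoringCond r => p.value.support) hAc
  obtain ⟨h, hh⟩ := exists_not_countable_fiber
    (fun (p : ColoringCond r) (x : R) => p.value x) hB₀c
  set B := {p ∈ B₀ | (fun x : R => p.value x) = h}
  have hBR : ∀ p ∈ B, ∀ q ∈ B, ∀ x ∈ R, p.value x = q.value x := fun p hp q hq x hx =>
    congrFun (hp.2.trans hq.2.symm) ⟨x, hx⟩
  have hBRn : ∀ p ∈ B, ∀ x ∈ R, p.value x ≠ 0 := fun p hp x hx =>
    Finsupp.mem_support_iff.1 (hR p hp.1 hx)
  have hBc : ∀ x ∉ R, {p ∈ B | p.value x ≠ 0}.Countable := fun x hx => by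
    refine (hRc x hx).mono ?_
    intro q hq
    exact ⟨hq.1.1, Finsupp.mem_support_iff.2 hq.2⟩
  obtain ⟨p, hp, hpc⟩ := exists_eventually_not_lt hchain htot
    (fun p : ColoringCond r => p.value.support \ R) (fun p => p.side) hh (fun x => by
      by_cases hx : x ∈ R
      · simp [hx]
      · refine (hBc x hx).mono ?_
        intro q hq
        exact ⟨hq.1, Finsupp.mem_support_iff.1 (Finset.mem_sdiff.1 hq.2).1⟩)
  let Z : Set T := ((p.value.support : Set T) ∪ ⋃ s ∈ p.side, Iio s) \ R
  have hZ : Z.Countable := by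
    refine (Countable.union (Finset.countable_toSet _) ?_).mono sdiff_subset
    exact p.side.countable_toSet.biUnion fun s _ => hIio s
  have hbad : ({p} ∪ ⋃ x ∈ Z, {q ∈ B | q.value x ≠ 0}).Countable :=
    (countable_singleton p).union (hZ.biUnion fun x hx => hBc x hx.2)
  have : ∃ q ∈ {q ∈ B | ¬ ∃ x ∈ p.value.support \ R, ∃ s ∈ q.side, x < s},
      q ∉ ({p} ∪ ⋃ x ∈ Z, {q ∈ B | q.value x ≠ 0}) := by
    by_contra hcon
    refine hpc (hbad.mono ?_)
    intro q hq
    by_contra h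
    exact hcon ⟨q, hq, h⟩
  obtain ⟨q, ⟨hqB, hq⟩, hqn⟩ := this
  simp only [mem_union, mem_singleton_iff, mem_iUnion, not_or, not_exists] at hqn
  obtain ⟨hqp, hqZ⟩ := hqn
  have hqZ' : ∀ x ∈ Z, q.value x = 0 := fun x hx => by
    by_contra hne
    exact hqZ x hx ⟨hqB, hne⟩
  refine hA (hB₀ hp.1) (hB₀ hqB.1) (Ne.symm hqp) (ColoringCond.exists_upper_bound ?_ ?_ ?_)
  · intro x hx hx'
    by_cases hxR : x ∈ R
    · exact hBR p hp q hqB x hxR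
    · exact absurd (hqZ' x ⟨Or.inl (by simpa using hx), hxR⟩) hx'
  · intro s hs x hxs hx
    by_cases hxR : x ∈ R
    · exact hBRn p hp x hxR
    · exact absurd (hqZ' x ⟨Or.inr (mem_biUnion hs hxs), hxR⟩) hx
  · intro s hs x hxs hx
    by_cases hxR : x ∈ R
    · exact hBRn q hqB x hxR
    · exact absurd ⟨x, Finset.mem_sdiff.2 ⟨by simpa using hx, hxR⟩, s, hs, hxs⟩ hq

namespace ColoringCond

variable {T W : Type*} [PartialOrder T] {r : T → W}

theorem exists_le_mem_side (t : T) (p : ColoringCond r) : ∃ q, t ∈ q.side ∧ p ≤ q :=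
  ⟨⟨p.value, insert t p.side, p.bound⟩, Finset.mem_insert_self _ _, le_def.2
    ⟨Finset.subset_insert _ _, le_rfl, fun _ _ => rfl, fun _ _ _ _ h h' => absurd h h'⟩⟩

theorem exists_le_lt_bound (n : ℕ) (p : ColoringCond r) : ∃ q, n < q.bound ∧ p ≤ q :=
  ⟨⟨p.value, p.side, max p.bound (n + 1)⟩, by simp, le_def.2
    ⟨subset_rfl, le_max_left _ _, fun _ _ => rfl, fun _ _ _ _ h h' => absurd h h'⟩⟩

theorem exists_le_value_ne_zero [LinearOrder W] (hr : IsLevelMap r) {t : T} {w : W}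
    (hw : (Ico w (r t)).Infinite) (p : ColoringCond r) :
    ∃ q, (∃ y < t, w ≤ r y ∧ q.value y ≠ 0) ∧ p ≤ q := by
  obtain ⟨p', htp, hpp'⟩ := exists_le_mem_side t p
  obtain ⟨v, ⟨hwv, hvt⟩, hv⟩ := (hw.sdiff (p'.value.support.image r).finite_toSet).nonempty
  have hv' : ∀ x, r x = v → p'.value x = 0 := by
    intro x hx
    by_contra hne
    exact hv (Finset.mem_coe.2 (Finset.mem_image.2 ⟨x, by simpa using hne, hx⟩))
  have hfin : {z | r z = v ∧ ∃ s ∈ p'.side, z < s}.Finite := by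
    have : {z | r z = v ∧ ∃ s ∈ p'.side, z < s} = ⋃ s ∈ p'.side, {z | r z = v ∧ z < s} := by
      ext z
      simp only [mem_ofPred_eq, mem_iUnion]
      tauto
    rw [this]
    refine p'.side.finite_toSet.biUnion fun s _ => Set.Subsingleton.finite ?_
    rintro x ⟨hx, hxs⟩ y ⟨hy, hys⟩
    exact hr.eq_of_eq hxs hys (hx.trans hy.symm)
  let N : T →₀ ℕ := Finsupp.onFinset hfin.toFinset
    (fun z => if r z = v ∧ ∃ s ∈ p'.side, z < s then p'.bound + 1 else 0) (by
      intro z hz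
      by_contra h
      exact hz (if_neg (by simpa using h)))
  have hN : ∀ s ∈ p'.side, ∀ z < s, r z = v → N z = p'.bound + 1 := fun s hs z hz hzv =>
    if_pos ⟨hzv, s, hs, hz⟩
  have hN0 : ∀ z, r z ≠ v → N z = 0 := fun z hz => if_neg fun h => hz h.1
  obtain ⟨y, hyt, hyv⟩ := hr.exists_lt t v hvt
  refine ⟨⟨p'.value + N, p'.side, p'.bound⟩,
    ⟨y, hyt, hyv ▸ hwv, ?_⟩, hpp'.trans (le_def.2 ⟨subset_rfl, le_rfl, fun x hx => ?_,
      fun s hs x hxs h0 h1 => ?_⟩)⟩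
  · simp [hN t htp y hyt hyv]
  · have : N x = 0 := hN0 x fun h => hx (hv' x h)
    simp [this]
  · have hxv : r x = v := by
      by_contra h
      exact h1 (by simp [h0, hN0 x h])
    have hx := hN s hs x hxs hxv
    refine ⟨by simp [h0, hx], fun t' ht' z hz hxz => ?_⟩
    have hzv : r z = v := hxz ▸ hxv
    simp [h0, hx, hv' z hzv, hN t' ht' z hz hzv]

end ColoringCond

/-- Under `MA(ω₁)`, an Aronszajn tree carries a colouring which is coherent modulo finite sets,
finite-to-one along branches on nonzero colours, and often nonzero. -/
theorem exists_coherent_coloring (hMA : MAomega1.{u}) {T W : Type u} [PartialOrder T]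
    [LinearOrder W] {r : T → W} (hr : IsLevelMap r) (hchain : NoUncountableChain T)
    (hIio : ∀ t : T, (Iio t).Countable) (hT : Cardinal.mk T ≤ Cardinal.aleph 1)
    (hW : Cardinal.mk W ≤ Cardinal.aleph 1) :
    ∃ g : T → ℕ,
      (∀ s t, {w | ∃ x < s, ∃ y < t, r x = w ∧ r y = w ∧ g x ≠ g y}.Finite) ∧
      (∀ t, ∀ n ≠ 0, {x | x < t ∧ g x = n}.Finite) ∧
      ∀ t w, (Ico w (r t)).Infinite → ∃ y < t, w ≤ r y ∧ g y ≠ 0 := by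
  let I := T ⊕ ULift.{u} ℕ ⊕ {x : T × W // (Ico x.2 (r x.1)).Infinite}
  let D : I → Set (ColoringCond r)
    | .inl t => {q | t ∈ q.side}
    | .inr (.inl n) => {q | n.down < q.bound}
    | .inr (.inr x) => {q | ∃ y < x.1.1, x.1.2 ≤ r y ∧ q.value y ≠ 0}
  have haleph : (Cardinal.aleph0 : Cardinal.{u}) ≤ Cardinal.aleph 1 := Cardinal.aleph0_le_aleph 1
  have hI : Cardinal.mk I ≤ Cardinal.aleph 1 := by
    simp only [I, Cardinal.mk_sum, Cardinal.lift_id]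
    refine Cardinal.add_le_of_le haleph hT (Cardinal.add_le_of_le haleph (by simp) ?_)
    refine (Cardinal.mk_subtype_le _).trans ?_
    rw [Cardinal.mk_prod, Cardinal.lift_id, Cardinal.lift_id]
    exact Cardinal.mul_le_of_le haleph hT hW
  obtain ⟨G, hdir, -, hG⟩ := hMA (ColoringCond r) ⟨⟨0, ∅, 0⟩⟩
    (ColoringCond.countable_of_pairwise hchain hr.lt_trichotomy hIio) (range D)
    (Cardinal.mk_range_le.trans hI) (by
      rintro _ ⟨t | n | x, rfl⟩ p
      · exact ColoringCond.exists_le_mem_side t p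
      · exact ColoringCond.exists_le_lt_bound n.down p
      · exact ColoringCond.exists_le_value_ne_zero hr x.2 p)
  let g : T → ℕ := fun x => if h : ∃ p ∈ G, p.value x ≠ 0 then h.choose.value x else 0
  have hg : ∀ p ∈ G, ∀ x, p.value x ≠ 0 → g x = p.value x := by
    intro p hp x hx
    have h : ∃ p ∈ G, p.value x ≠ 0 := ⟨p, hp, hx⟩
    obtain ⟨h1, h2⟩ := h.choose_spec
    obtain ⟨u, -, hu1, hu2⟩ := hdir _ hp _ h1
    simp only [g, dif_pos h]
    rw [← ColoringCond.value_eq_of_le hu1 hx, ← ColoringCond.value_eq_of_le hu2 h2]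
  have hg' : ∀ p ∈ G, ∀ x, g x ≠ 0 → ∃ q ∈ G, p ≤ q ∧ q.value x = g x := by
    intro p hp x hx
    have h : ∃ p ∈ G, p.value x ≠ 0 := by
      by_contra h
      exact hx (dif_neg h)
    obtain ⟨q, hq, hqx⟩ := h
    obtain ⟨u, hu, hu1, hu2⟩ := hdir _ hp _ hq
    exact ⟨u, hu, hu1, by rw [hg q hq x hqx, ColoringCond.value_eq_of_le hu2 hqx]⟩
  have hside : ∀ t, ∃ p ∈ G, t ∈ p.side := fun t => hG _ ⟨.inl t, rfl⟩
  refine ⟨g, fun s t => ?_, fun t n hn => ?_, fun t w hw => ?_⟩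
  · obtain ⟨p, hp, hps⟩ := hside s
    obtain ⟨p', hp', hpt⟩ := hside t
    obtain ⟨u, hu, hu1, hu2⟩ := hdir _ hp _ hp'
    have hus := hu1.1 hps
    have hut := hu2.1 hpt
    have key : ∀ s ∈ u.side, ∀ t ∈ u.side, ∀ x < s, ∀ y < t, r x = r y → u.value x = 0 →
        g x ≠ 0 → g y = g x := by
      intro s hs t ht x hxs y hyt hxy h0 hgx
      obtain ⟨q, hq, huq, hqx⟩ := hg' u hu x hgx
      have h1 := ((ColoringCond.le_def.1 huq).2.2.2 s hs x hxs h0 (hqx ▸ hgx)).2 t ht y hyt hxy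
      rw [← hqx, ← h1]
      exact hg q hq y (by rw [h1, hqx]; exact hgx)
    refine ((u.value.support.image r).finite_toSet).subset ?_
    rintro w ⟨x, hxs, y, hyt, hxw, hyw, hne⟩
    by_contra hw
    have hv : ∀ z, r z = w → u.value z = 0 := by
      intro z hz
      by_contra h
      exact hw (Finset.mem_coe.2 (Finset.mem_image.2 ⟨z, by simpa using h, hz⟩))
    by_cases hx0 : g x = 0
    · have hy0 : g y ≠ 0 := fun h => hne (hx0.trans h.symm)
      exact hne (key t hut s hus y hyt x hxs (hyw.trans hxw.symm) (hv y hyw) hy0)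
    · exact hne (key s hus t hut x hxs y hyt (hxw.trans hyw.symm) (hv x hxw) hx0).symm
  · obtain ⟨p, hp, hpt⟩ := hside t
    obtain ⟨p', hp', hpn⟩ : ∃ p ∈ G, n < p.bound := hG _ ⟨.inr (.inl ⟨n⟩), rfl⟩
    obtain ⟨u, hu, hu1, hu2⟩ := hdir _ hp _ hp'
    refine u.value.support.finite_toSet.subset ?_
    rintro x ⟨hxt, hxn⟩
    rw [Finset.mem_coe, Finsupp.mem_support_iff]
    intro h0
    obtain ⟨q, hq, huq, hqx⟩ := hg' u hu x (hxn ▸ hn)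
    have h1 := ((ColoringCond.le_def.1 huq).2.2.2 t (hu1.1 hpt) x hxt h0 (by
      rw [hqx, hxn]; exact hn)).1
    have h2 := hu2.2.1
    omega
  · obtain ⟨p, hp, y, hyt, hwy, hy⟩ := hG _ ⟨.inr (.inr ⟨(t, w), hw⟩), rfl⟩
    exact ⟨y, hyt, hwy, by rwa [hg p hp y hy]⟩

/-! ### Linear orders of type `ω₁` -/

section OmegaOne

variable {W : Type u} [LinearOrder W]

theorem exists_forall_lt_of_countable [Uncountable W] (hW : ∀ w : W, (Iio w).Countable)
    {Z : Set W} (hZ : Z.Countable) : ∃ w, ∀ z ∈ Z, z < w := by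
  by_contra! h
  refine not_countable_univ (α := W) ((hZ.biUnion fun z _ =>
    (Iio_union_right (a := z) ▸ (hW z).union (countable_singleton z) : (Iic z).Countable)).mono ?_)
  intro w _
  obtain ⟨z, hz, hwz⟩ := h w
  exact mem_biUnion hz hwz

theorem exists_gt_closed [WellFoundedLT W] [Uncountable W] (hW : ∀ w : W, (Iio w).Countable)
    (F : W → W) (a : W) : ∃ l, a < l ∧ ∀ w < l, F w < l := by
  have hstep : ∀ c : W, ∃ d, c < d ∧ ∀ w ≤ c, F w < d := by
    intro c
    have hc : (insert c (F '' Iic c)).Countable := by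
      refine Countable.insert c (Countable.image ?_ F)
      rw [← Iio_union_right]
      exact (hW c).union (countable_singleton c)
    obtain ⟨d, hd⟩ := exists_forall_lt_of_countable hW hc
    exact ⟨d, hd c (mem_insert _ _), fun w hw => hd _ (mem_insert_of_mem _ ⟨w, hw, rfl⟩)⟩
  choose d hd hFd using hstep
  let s : ℕ → W := fun n => d^[n] a
  have hs : ∀ n, s (n + 1) = d (s n) := fun n => Function.iterate_succ_apply' d n a
  have hne := exists_forall_lt_of_countable hW (countable_range s)
  obtain ⟨l, hl, hmin⟩ := WellFounded.has_min wellFounded_lt {w | ∀ z ∈ range s, z < w} hne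
  refine ⟨l, hl a ⟨0, rfl⟩, fun w hw => ?_⟩
  have : ∃ n, w ≤ s n := by
    by_contra! h
    exact hmin w (by rintro _ ⟨n, rfl⟩; exact h n) hw
  obtain ⟨n, hn⟩ := this
  exact (hFd _ _ hn).trans (hl _ ⟨n + 1, hs n⟩)

theorem exists_gt_forall_exists_between [WellFoundedLT W] [Uncountable W]
    (hW : ∀ w : W, (Iio w).Countable) (a : W) :
    ∃ l, a < l ∧ ∀ w < l, ∃ v, w < v ∧ v < l := by
  have hgt : ∀ w : W, ∃ v, w < v := fun w => by
    obtain ⟨v, hv⟩ := exists_forall_lt_of_countable hW (countable_singleton w)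
    exact ⟨v, hv w rfl⟩
  choose F hF using hgt
  obtain ⟨l, hal, hl⟩ := exists_gt_closed hW F a
  exact ⟨l, hal, fun w hw => ⟨F w, hF w, hl w hw⟩⟩

theorem exists_lt_of_finite {l : W} (hne : ∃ a, a < l) (hl : ∀ w < l, ∃ v, w < v ∧ v < l)
    {E : Set W} (hE : E.Finite) (hEl : ∀ e ∈ E, e < l) : ∃ w < l, ∀ e ∈ E, e < w := by
  induction E, hE using Set.Finite.induction_on with
  | empty =>
    obtain ⟨a, ha⟩ := hne
    exact ⟨a, ha, by simp⟩
  | @insert a s _ _ ih =>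
    obtain ⟨w, hw, hws⟩ := ih fun e he => hEl e (mem_insert_of_mem _ he)
    obtain ⟨v, hv, hvl⟩ := hl (max a w) (max_lt (hEl a (mem_insert _ _)) hw)
    refine ⟨v, hvl, ?_⟩
    rintro e (rfl | he)
    · exact (le_max_left _ _).trans_lt hv
    · exact (hws e he).trans ((le_max_right _ _).trans_lt hv)

/-- A weak form of the pressing down lemma. -/
theorem exists_uncountable_bounded [WellFoundedLT W] [Uncountable W]
    (hW : ∀ w : W, (Iio w).Countable) (D : W → Set W) (hD : ∀ w, (D w).Finite)
    (hDw : ∀ w, ∀ v ∈ D w, v < w) : ∃ c, ¬ {w | ∀ v ∈ D w, v < c}.Countable := by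
  by_contra! h
  have hF : ∀ c, ∃ d, c < d ∧ ∀ w, (∀ v ∈ D w, v < c) → w < d := by
    intro c
    obtain ⟨d, hd⟩ := exists_forall_lt_of_countable hW ((h c).insert c)
    exact ⟨d, hd c (mem_insert _ _), fun w hw => hd w (mem_insert_of_mem _ hw)⟩
  choose F hcF hF using hF
  have hne : Nonempty W := inferInstance
  obtain ⟨l, hl, hFl⟩ := exists_gt_closed hW F hne.some
  obtain ⟨c, hc, hcD⟩ := exists_lt_of_finite ⟨_, hl⟩ (fun w hw => ⟨F w, hcF w, hFl w hw⟩)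
    (hD l) (hDw l)
  exact lt_asymm (hF c l hcD) (hFl c hc)

theorem exists_mem_gt_of_not_countable (hW : ∀ w : W, (Iio w).Countable) {A : Set W}
    (hA : ¬ A.Countable) (w : W) : ∃ a ∈ A, w < a := by
  by_contra! h
  refine hA (((hW w).union (countable_singleton w)).mono ?_)
  rw [Iio_union_right]
  exact h

end OmegaOne

/-! ### The shifted coherent tree -/

/-- The positions `w` with `w + 1 < d`. -/
def shiftDom {W : Type*} [LinearOrder W] (d : W) : Set W :=
  {w | ∃ v, w < v ∧ v < d}

theorem shiftDom_mono {W : Type*} [LinearOrder W] {d e : W} (h : d ≤ e) :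
    shiftDom d ⊆ shiftDom e :=
  fun _ ⟨v, hv, hvd⟩ => ⟨v, hv, hvd.trans_le h⟩

theorem lt_of_mem_shiftDom {W : Type*} [LinearOrder W] {w d : W} (h : w ∈ shiftDom d) : w < d :=
  let ⟨_, hv, hvd⟩ := h
  hv.trans hvd

/-- The tree whose level `d` consists of the functions on `shiftDom d` that differ from `c d` at
finitely many points. -/
@[ext]
structure ShiftTree {W : Type u} [LinearOrder W] (c : W → W → ℕ) : Type u where
  level : W
  fn : W → ℕ
  fn_eq_zero : ∀ w ∉ shiftDom level, fn w = 0
  finite_ne : {w | w ∈ shiftDom level ∧ fn w ≠ c level w}.Finite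

namespace ShiftTree

variable {W : Type u} [LinearOrder W] {c : W → W → ℕ}

instance : PartialOrder (ShiftTree c) where
  le p q := p.level ≤ q.level ∧ ∀ w ∈ shiftDom p.level, p.fn w = q.fn w
  le_refl p := ⟨le_rfl, fun _ _ => rfl⟩
  le_trans p q s h k :=
    ⟨h.1.trans k.1, fun w hw => (h.2 w hw).trans (k.2 w (shiftDom_mono h.1 hw))⟩
  le_antisymm p q h k := by
    have hl := h.1.antisymm k.1
    refine ShiftTree.ext hl (funext fun w => ?_)
    by_cases hw : w ∈ shiftDom p.level
    · exact h.2 w hw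
    · rw [p.fn_eq_zero w hw, q.fn_eq_zero w (hl ▸ hw)]

theorem lt_of_le_of_level_lt {p q : ShiftTree c} (h : p ≤ q) (hl : p.level < q.level) : p < q :=
  h.lt_of_ne fun e => hl.ne (congrArg level e)

/-- The node of level `d` determined by `c d`. -/
noncomputable def base (c : W → W → ℕ) (d : W) : ShiftTree c where
  level := d
  fn w := if w ∈ shiftDom d then c d w else 0
  fn_eq_zero _ hw := if_neg hw
  finite_ne := by
    convert finite_empty (α := W)
    ext w
    simp only [mem_ofPred_eq, mem_empty_iff_false, iff_false]
    rintro ⟨h, h'⟩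
    exact h' (if_pos h)

/-- The predecessor of `p` at level `d`. -/
noncomputable def restrict (hc : ∀ d e, d ≤ e → {w | w < d ∧ c d w ≠ c e w}.Finite)
    (p : ShiftTree c) (d : W) (hd : d ≤ p.level) : ShiftTree c where
  level := d
  fn w := if w ∈ shiftDom d then p.fn w else 0
  fn_eq_zero _ hw := if_neg hw
  finite_ne := by
    refine (p.finite_ne.union (hc d p.level hd)).subset ?_
    rintro w ⟨hw, hne⟩
    rw [if_pos hw] at hne
    by_cases h : p.fn w = c p.level w
    · exact Or.inr ⟨lt_of_mem_shiftDom hw, fun h' => hne (h.trans h'.symm)⟩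
    · exact Or.inl ⟨shiftDom_mono hd hw, h⟩

theorem restrict_le (hc : ∀ d e, d ≤ e → {w | w < d ∧ c d w ≠ c e w}.Finite)
    (p : ShiftTree c) (d : W) (hd : d ≤ p.level) : restrict hc p d hd ≤ p :=
  ⟨hd, fun _ hw => if_pos hw⟩

theorem isLevelMap_level (hc : ∀ d e, d ≤ e → {w | w < d ∧ c d w ≠ c e w}.Finite) :
    IsLevelMap (level : ShiftTree c → W) where
  strictMono _ _ h := h.le.1.lt_of_ne fun e => h.not_ge ⟨e.ge, fun w hw =>
    (h.le.2 w (e ▸ hw)).symm⟩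
  exists_lt p w hw :=
    ⟨restrict hc p w hw.le, lt_of_le_of_level_lt (restrict_le hc p w hw.le) hw, rfl⟩
  le_of_le _ _ _ hx hy h :=
    ⟨h, fun w hw => (hx.le.2 w hw).trans (hy.le.2 w (shiftDom_mono h hw)).symm⟩

theorem countable_level (hW : ∀ w : W, (Iio w).Countable) (d : W) :
    {p : ShiftTree c | p.level = d}.Countable := by
  have : Countable (Iio d) := (hW d).to_subtype
  let f : ShiftTree c → Set (Iio d × ℕ) := fun p =>
    {x | (x.1 : W) ∈ shiftDom d ∧ p.fn x.1 ≠ c d x.1 ∧ x.2 = p.fn x.1}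
  have hfin : ∀ p ∈ {p : ShiftTree c | p.level = d}, (f p).Finite := by
    rintro p rfl
    refine Set.Finite.of_injOn (f := fun x => (x.1 : W)) (t := {w | w ∈ shiftDom p.level ∧
      p.fn w ≠ c p.level w}) (fun x hx => ⟨hx.1, hx.2.1⟩) ?_ p.finite_ne
    rintro ⟨x, m⟩ ⟨-, -, hm⟩ ⟨y, k⟩ ⟨-, -, hk⟩ hxy
    have hxy : x = y := Subtype.ext hxy
    subst hxy
    exact Prod.ext rfl (hm.trans hk.symm)
  have himg : (f '' {p : ShiftTree c | p.level = d}).Countable := by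
    refine (Set.countable_ofPred_finite_subset (countable_univ (α := Iio d × ℕ))).mono ?_
    rintro _ ⟨p, hp, rfl⟩
    exact ⟨hfin p hp, subset_univ _⟩
  refine countable_of_injective_of_countable_image ?_ himg
  rintro p hp q hq hpq
  have hpd : p.level = d := hp
  have hqd : q.level = d := hq
  refine ShiftTree.ext (hpd.trans hqd.symm) (funext fun w => ?_)
  by_cases hw : w ∈ shiftDom d
  · have key : ∀ p q : ShiftTree c, f p = f q → p.fn w ≠ c d w → p.fn w = q.fn w := by
      intro p q h hne
      have : ((⟨w, lt_of_mem_shiftDom hw⟩, p.fn w) : Iio d × ℕ) ∈ f q :=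
        h ▸ ⟨hw, hne, rfl⟩
      exact this.2.2
    by_cases h1 : p.fn w = c d w
    · by_cases h2 : q.fn w = c d w
      · rw [h1, h2]
      · exact (key q p hpq.symm h2).symm
    · exact key p q hpq h1
  · rw [p.fn_eq_zero w (hpd ▸ hw), q.fn_eq_zero w (hqd ▸ hw)]

theorem noUncountableChain (hW : ∀ w : W, (Iio w).Countable) [Uncountable W]
    (hc : ∀ d e, d ≤ e → {w | w < d ∧ c d w ≠ c e w}.Finite)
    (hb : ∀ b : W → ℕ, ∃ d, ¬ {w | w < d ∧ b w ≠ c d w}.Finite) :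
    NoUncountableChain (ShiftTree c) := by
  intro C hC
  by_contra hCc
  have hinj : InjOn level C := by
    intro p hp q hq h
    by_contra hne
    rcases hC hp hq hne with h' | h'
    · exact ((isLevelMap_level hc).strictMono h').ne h
    · exact ((isLevelMap_level hc).strictMono h').ne h.symm
  have hlev : ∀ w, ∃ p ∈ C, w < p.level := by
    intro w
    obtain ⟨_, ⟨p, hp, rfl⟩, h⟩ := exists_mem_gt_of_not_countable hW
      (fun h => hCc (countable_of_injective_of_countable_image hinj h)) w
    exact ⟨p, hp, h⟩
  have hdom : ∀ w, ∃ p ∈ C, w ∈ shiftDom p.level := by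
    intro w
    obtain ⟨v, hv⟩ := exists_forall_lt_of_countable hW (countable_singleton w)
    obtain ⟨p, hp, h⟩ := hlev v
    exact ⟨p, hp, v, hv w rfl, h⟩
  choose P hPC hP using hdom
  obtain ⟨d, hd⟩ := hb fun w => (P w).fn w
  obtain ⟨p, hp, hdp⟩ := hlev d
  refine hd ((p.finite_ne.union (hc d p.level hdp.le)).subset ?_)
  rintro w ⟨hwd, hne⟩
  have hwp : w ∈ shiftDom p.level := ⟨d, hwd, hdp⟩
  have hpw : (P w).fn w = p.fn w := by
    by_cases h : P w = p
    · rw [h]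
    rcases hC (hPC w) hp h with h | h
    · exact h.le.2 w (hP w)
    · exact (h.le.2 w hwp).symm
  by_cases h : p.fn w = c p.level w
  · exact Or.inr ⟨hwd, fun h' => hne (hpw.trans (h.trans h'.symm))⟩
  · exact Or.inl ⟨hwp, h⟩

end ShiftTree

/-- The colouring read along the predecessors of `t`, indexed by levels. -/
noncomputable def branchFn {T W : Type*} [PartialOrder T] (r : T → W) (g : T → ℕ) (t : T) (w : W) :
    ℕ :=
  if h : ∃ x < t, r x = w then g h.choose else 0

theorem IsLevelMap.branchFn_eq {T W : Type*} [PartialOrder T] [LinearOrder W] {r : T → W}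
    (hr : IsLevelMap r) (g : T → ℕ) {x t : T} (hx : x < t) : branchFn r g t (r x) = g x := by
  have h : ∃ y < t, r y = r x := ⟨x, hx, rfl⟩
  rw [branchFn, dif_pos h, hr.eq_of_eq h.choose_spec.1 hx h.choose_spec.2]

theorem IsLevelMap.branchFn_eq_of_le {T W : Type*} [PartialOrder T] [LinearOrder W] {r : T → W}
    (hr : IsLevelMap r) (g : T → ℕ) {s t : T} (hst : s ≤ t) {w : W} (hw : w < r s) :
    branchFn r g s w = branchFn r g t w := by
  obtain ⟨x, hx, rfl⟩ := hr.exists_lt s w hw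
  rw [hr.branchFn_eq g hx, hr.branchFn_eq g (hx.trans_le hst)]

theorem IsLevelMap.finite_branchFn_ne {T W : Type*} [PartialOrder T] [LinearOrder W] {r : T → W}
    (hr : IsLevelMap r) {g : T → ℕ}
    (hg : ∀ s t, {w | ∃ x < s, ∃ y < t, r x = w ∧ r y = w ∧ g x ≠ g y}.Finite) {s t : T} {d : W}
    (hs : d ≤ r s) (ht : d ≤ r t) : {w | w < d ∧ branchFn r g s w ≠ branchFn r g t w}.Finite := by
  refine (hg s t).subset ?_
  rintro w ⟨hwd, hne⟩
  obtain ⟨x, hx, hxw⟩ := hr.exists_lt s w (hwd.trans_le hs)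
  obtain ⟨y, hy, hyw⟩ := hr.exists_lt t w (hwd.trans_le ht)
  refine ⟨x, hx, y, hy, hxw, hyw, fun h => hne ?_⟩
  have h1 := hr.branchFn_eq g hx
  have h2 := hr.branchFn_eq g hy
  rw [hxw] at h1
  rw [hyw] at h2
  rw [h1, h2, h]

/-- A coherent colouring that is finite-to-one on nonzero colours and often nonzero has no
uncountable branch modulo finite sets. -/
theorem exists_not_finite_branchFn_ne {T W : Type u} [PartialOrder T] [LinearOrder W]
    [WellFoundedLT W] [Uncountable W] (hW : ∀ w : W, (Iio w).Countable) {r : T → W}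
    (hr : IsLevelMap r) {g : T → ℕ} (hg1 : ∀ t, ∀ n ≠ 0, {x | x < t ∧ g x = n}.Finite)
    (hg2 : ∀ t w, (Ico w (r t)).Infinite → ∃ y < t, w ≤ r y ∧ g y ≠ 0)
    {τ : W → T} (hτ : ∀ w, r (τ w) = w) (b : W → ℕ) :
    ∃ d, ¬ {w | w < d ∧ b w ≠ branchFn r g (τ d) w}.Finite := by
  by_contra! hb
  have hn : ∀ n ≠ 0, {w | b w = n}.Finite := by
    intro n hn
    by_contra hc
    let e := Set.Infinite.natEmbedding _ hc
    obtain ⟨d, hd⟩ := exists_forall_lt_of_countable hW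
      (countable_range fun k => (e k : W))
    refine Set.infinite_range_of_injective (Subtype.val_injective.comp e.injective)
      (((hb d).union ((hg1 (τ d) n hn).image r)).subset ?_)
    rintro _ ⟨k, rfl⟩
    have hkd : (e k : W) < d := hd _ ⟨k, rfl⟩
    have hk : b (e k) = n := (e k).2
    by_cases h : b (e k) = branchFn r g (τ d) (e k)
    · obtain ⟨x, hx, hxk⟩ := hr.exists_lt (τ d) (e k) ((hτ d).symm ▸ hkd)
      refine Or.inr ⟨x, ⟨hx, ?_⟩, hxk⟩
      rw [← hr.branchFn_eq g hx, hxk, ← h, hk]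
    · exact Or.inl ⟨hkd, h⟩
  have hZ : {w | b w ≠ 0}.Countable := by
    refine (countable_iUnion fun n : ℕ => (hn (n + 1) n.succ_ne_zero).countable).mono ?_
    intro w hw
    exact mem_iUnion.2 ⟨b w - 1, (Nat.succ_pred_eq_of_ne_zero hw).symm⟩
  obtain ⟨a, ha⟩ := exists_forall_lt_of_countable hW hZ
  obtain ⟨l, hal, hl⟩ := exists_gt_forall_exists_between hW a
  obtain ⟨v, hvl, hv⟩ := exists_lt_of_finite ⟨a, hal⟩ hl (hb l) fun w hw => hw.1
  have hinf : (Ico (max v a) (r (τ l))).Infinite := by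
    rw [hτ]
    intro hfin
    obtain ⟨u, hul, hu⟩ := exists_lt_of_finite ⟨a, hal⟩ hl hfin fun w hw => hw.2
    have h1 : max v a < u := hu _ ⟨le_rfl, max_lt hvl hal⟩
    exact lt_irrefl u (hu u ⟨h1.le, hul⟩)
  obtain ⟨y, hyt, hwy, hy⟩ := hg2 (τ l) _ hinf
  have hyl : r y < l := hτ l ▸ hr.strictMono hyt
  have hb0 : b (r y) = 0 := by
    by_contra h
    exact (ha _ h).not_ge ((le_max_right _ _).trans hwy)
  have hyE : r y < v := hv _ ⟨hyl, by rw [hb0, hr.branchFn_eq g hyt]; exact hy.symm⟩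
  exact hyE.not_ge ((le_max_left _ _).trans hwy)

theorem IsLevelMap.le_of_strictMono {S T W : Type*} [PartialOrder S] [PartialOrder T]
    [LinearOrder W] [WellFoundedLT W] {ρ : S → W} {r : T → W} (hρ : IsLevelMap ρ)
    (hr : IsLevelMap r) {f : S → T} (hf : StrictMono f) (p : S) : ρ p ≤ r (f p) := by
  induction h : ρ p using WellFoundedLT.induction generalizing p with
  | ind w ih =>
    subst h
    by_contra! hlt
    obtain ⟨q, hqp, hq⟩ := hρ.exists_lt p _ hlt
    have h1 := ih (ρ q) (hρ.strictMono hqp) q rfl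
    rw [hq] at h1
    exact h1.not_gt (hr.strictMono (hf hqp))

theorem not_strictMono_shiftTree {T W : Type u} [PartialOrder T] [LinearOrder W]
    [WellFoundedLT W] [Uncountable W] (hW : ∀ w : W, (Iio w).Countable) {r : T → W}
    (hr : IsLevelMap r) (hlev : ∀ w, {t | r t = w}.Countable) {g : T → ℕ}
    (hg : ∀ s t, {w | ∃ x < s, ∃ y < t, r x = w ∧ r y = w ∧ g x ≠ g y}.Finite)
    {τ : W → T} (hτ : ∀ w, r (τ w) = w)
    (hb : ∀ b : W → ℕ, ∃ d, ¬ {w | w < d ∧ b w ≠ branchFn r g (τ d) w}.Finite)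
    (f : ShiftTree (fun d => branchFn r g (τ d)) → T) : ¬ StrictMono f := by
  intro hf
  let c : W → W → ℕ := fun d => branchFn r g (τ d)
  have hc : ∀ d e, d ≤ e → {w | w < d ∧ c d w ≠ c e w}.Finite := fun d e hde =>
    hr.finite_branchFn_ne hg (hτ d).ge (hde.trans (hτ e).ge)
  have hρ := ShiftTree.isLevelMap_level hc
  have hfl : ∀ p, p.level ≤ r (f p) := hρ.le_of_strictMono hr hf
  let s : W → T := fun d => f (ShiftTree.base c d)
  have hs : ∀ d, d ≤ r (s d) := fun d => hfl (ShiftTree.base c d)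
  obtain ⟨a, ha⟩ := exists_uncountable_bounded hW
    (fun d => {w | w < d ∧ branchFn r g (s d) w ≠ c d w})
    (fun d => hr.finite_branchFn_ne hg (hs d) (hτ d).ge) (fun d w hw => hw.1)
  have ha' : ¬ {d | a < d ∧ ∀ w < d, a ≤ w → branchFn r g (s d) w = c d w}.Countable := by
    intro h
    refine ha ((h.union ((hW a).union (countable_singleton a))).mono ?_)
    intro d hd
    rw [Iio_union_right]
    rcases lt_or_ge a d with had | had
    · refine Or.inl ⟨had, fun w hw haw => ?_⟩
      by_contra hne
      exact (hd w ⟨hw, hne⟩).not_ge haw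
    · exact Or.inr had
  have hpred : ∀ d, a < d → ∃ x < τ d, r x = a := fun d hd =>
    hr.exists_lt (τ d) a ((hτ d).symm ▸ hd)
  have : Countable {t | r t = a} := (hlev a).to_subtype
  obtain ⟨x, hx⟩ := exists_not_countable_fiber (β := Option {t | r t = a}) (fun d =>
    if h : a < d then some ⟨(hpred d h).choose, (hpred d h).choose_spec.2⟩ else none) ha'
  set A := {d ∈ {d | a < d ∧ ∀ w < d, a ≤ w → branchFn r g (s d) w = c d w} |
    (if h : a < d then some ⟨(hpred d h).choose, (hpred d h).choose_spec.2⟩ else none) = x}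
  have hroot : ∀ d ∈ A, ∀ e ∈ A, ∀ w < a, c d w = c e w := by
    rintro d ⟨⟨hd, -⟩, hdx⟩ e ⟨⟨he, -⟩, hex⟩ w hw
    rw [← hex, dif_pos hd, dif_pos he] at hdx
    have hde : (hpred d hd).choose = (hpred e he).choose :=
      congrArg Subtype.val (Option.some_injective _ hdx)
    obtain ⟨h1, h2⟩ := (hpred d hd).choose_spec
    obtain ⟨h3, -⟩ := (hpred e he).choose_spec
    have hwx : w < r (hpred d hd).choose := h2.symm ▸ hw
    change branchFn r g (τ d) w = branchFn r g (τ e) w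
    rw [← hr.branchFn_eq_of_le g h1.le hwx, ← hr.branchFn_eq_of_le g h3.le (hde ▸ hwx), hde]
  have hagree : ∀ d ∈ A, ∀ e ∈ A, d ≤ e → ∀ w < d, c d w = c e w := by
    intro d hd e he hde w
    induction w using WellFoundedLT.induction with
    | ind w ih =>
    intro hwd
    rcases lt_or_ge w a with hwa | hwa
    · exact hroot d hd e he w hwa
    obtain ⟨v, hwv, hv⟩ : ∃ v, w < v ∧ ∀ u, w < u → v ≤ u := by
      obtain ⟨v, hv, hmin⟩ := WellFounded.has_min wellFounded_lt (Ioi w) ⟨d, hwd⟩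
      exact ⟨v, hv, fun u hu => not_lt.1 (hmin u hu)⟩
    have hvd : v ≤ d := hv d hwd
    have hdom : ∀ u ∈ shiftDom v, u < w := by
      rintro u ⟨z, huz, hzv⟩
      by_contra! hwu
      exact hzv.not_ge (hv z (hwu.trans_lt huz))
    let y := ShiftTree.restrict hc (ShiftTree.base c d) v hvd
    have hyd : y ≤ ShiftTree.base c d := ShiftTree.restrict_le hc _ v hvd
    have hye : y ≤ ShiftTree.base c e := by
      refine ⟨hvd.trans hde, fun u hu => ?_⟩
      have hu' : u ∈ shiftDom v := hu
      rw [hyd.2 u hu]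
      change (if u ∈ shiftDom d then c d u else 0) = (if u ∈ shiftDom e then c e u else 0)
      rw [if_pos (shiftDom_mono hvd hu'), if_pos (shiftDom_mono (hvd.trans hde) hu')]
      exact ih u (hdom u hu') ((hdom u hu').trans hwd)
    have hwy : w < r (f y) := hwv.trans_le (hfl y)
    have h1 := hr.branchFn_eq_of_le g (hf.monotone hyd) hwy
    have h2 := hr.branchFn_eq_of_le g (hf.monotone hye) hwy
    rw [← hd.1.2 w hwd hwa, ← he.1.2 w (hwd.trans_le hde) hwa]
    exact h1.symm.trans h2
  choose P hPA hP using exists_mem_gt_of_not_countable hW hx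
  obtain ⟨d, hd⟩ := hb fun w => c (P w) w
  obtain ⟨e, heA, he⟩ := exists_mem_gt_of_not_countable hW hx d
  refine hd ((hc d e he.le).subset ?_)
  rintro w ⟨hwd, hne⟩
  refine ⟨hwd, fun h => hne ?_⟩
  have hPe : c (P w) w = c e w := by
    rcases le_total (P w) e with h | h
    · exact hagree _ (hPA w) _ heA h w (hP w)
    · exact (hagree _ heA _ (hPA w) h w (hwd.trans he)).symm
  exact hPe.trans h.symm

/-! ### Heights -/

theorem treeHeight_eq_type {T : Type u} [PartialOrder T] (hT : IsTree T) (x : T) :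
    treeHeight x = @Ordinal.type {y : T // y < x} (fun a b => (a : T) < (b : T)) (hT x) :=
  dif_pos (hT x)

theorem treeHeight_eq_typein {T : Type u} [PartialOrder T] (hT : IsTree T) {x t : T} (h : x < t) :
    treeHeight x =
      @Ordinal.typein {y : T // y < t} (fun a b => (a : T) < (b : T)) (hT t) ⟨x, h⟩ := by
  have := hT x
  have := hT t
  rw [treeHeight_eq_type hT, ← Ordinal.type_subrel]
  refine Ordinal.type_eq.2 ⟨⟨⟨fun y => ⟨⟨y, y.2.trans h⟩, y.2⟩, fun y => ⟨y.1, y.2⟩, ?_, ?_⟩, ?_⟩⟩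
  · intro y; rfl
  · intro y; rfl
  · intro a b; rfl

theorem isLevelMap_of_treeHeight {T : Type u} [PartialOrder T] (hT : IsTree T) {W : Type u}
    [LinearOrder W] [WellFoundedLT W] {r : T → W}
    (hr : ∀ t, Ordinal.typein (α := W) (· < ·) (r t) = treeHeight t) : IsLevelMap r where
  strictMono x t h := by
    have := hT t
    rw [← Ordinal.typein_lt_typein (α := W) (· < ·), hr, hr, treeHeight_eq_typein hT h,
      treeHeight_eq_type hT t]
    exact Ordinal.typein_lt_type _ _
  exists_lt t w hw := by
    have := hT t
    rw [← Ordinal.typein_lt_typein (α := W) (· < ·), hr, treeHeight_eq_type hT t] at hw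
    obtain ⟨x, hx⟩ := Ordinal.typein_surj _ hw
    refine ⟨x, x.2, Ordinal.typein_injective (α := W) (· < ·) ?_⟩
    rw [hr, treeHeight_eq_typein hT x.2, ← hx]
  le_of_le t x y hx hy h := by
    have := hT t
    rw [← not_lt, ← Ordinal.typein_lt_typein (α := W) (· < ·), hr, hr,
      treeHeight_eq_typein hT hx, treeHeight_eq_typein hT hy, Ordinal.typein_lt_typein] at h
    have := (trichotomous_of (fun a b : {y : T // y < t} => (a : T) < (b : T)) ⟨x, hx⟩ ⟨y, hy⟩)
    rcases this with h1 | h1 | h1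
    · exact h1.le
    · exact (congrArg Subtype.val h1).le
    · exact absurd h1 h

theorem IsLevelMap.nonempty_relIso {S W : Type u} [PartialOrder S] [LinearOrder W] {r : S → W}
    (hr : IsLevelMap r) (x : S) :
    Nonempty ((fun a b : {y : S // y < x} => (a : S) < (b : S)) ≃r
      ((· < ·) : Iio (r x) → Iio (r x) → Prop)) := by
  let e : {y : S // y < x} → Iio (r x) := fun y => ⟨r y, hr.strictMono y.2⟩
  have he : Function.Bijective e := by
    refine ⟨fun a b h => Subtype.ext (hr.eq_of_eq a.2 b.2 (congrArg Subtype.val h)), ?_⟩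
    rintro ⟨w, hw⟩
    obtain ⟨y, hy, rfl⟩ := hr.exists_lt x w hw
    exact ⟨⟨y, hy⟩, rfl⟩
  refine ⟨⟨Equiv.ofBijective e he, ?_⟩⟩
  intro a b
  refine ⟨fun h => ?_, fun h => hr.strictMono h⟩
  have h' : r a < r b := h
  exact (hr.le_of_le x a b a.2 b.2 h'.le).lt_of_ne fun hab => h'.ne (congrArg r hab)

theorem IsLevelMap.isTree {S W : Type u} [PartialOrder S] [LinearOrder W] [WellFoundedLT W]
    {r : S → W} (hr : IsLevelMap r) : IsTree S := fun x =>
  (hr.nonempty_relIso x).some.toRelEmbedding.isWellOrder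

theorem IsLevelMap.treeHeight_eq {S W : Type u} [PartialOrder S] [LinearOrder W]
    [WellFoundedLT W] {r : S → W} (hr : IsLevelMap r) (x : S) :
    treeHeight x = Ordinal.typein (α := W) (· < ·) (r x) := by
  have := hr.isTree x
  rw [treeHeight_eq_type hr.isTree, ← Ordinal.type_Iio_lt]
  exact Ordinal.type_eq.2 (hr.nonempty_relIso x)

/-- Under MA(ω₁), for every Aronszajn tree `T` there is an Aronszajn tree `T*`
with no weak embedding from `T*` into `T`. -/
theorem exists_Aronszajn_not_embeddable (hMA : MAomega1.{u}) :
    ∀ (T : Type u) [PartialOrder T], IsAronszajn T →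
      ∃ S : PoType.{u}, IsAronszajn S.carrier ∧
        ¬ ∃ f : S.carrier → T, IsWeakEmbedding f := by
  intro T _ ⟨hT, ⟨hne, hlt⟩, hlev, hchain⟩
  let W : Type u := omega1.{u}.ToType
  have hWtype : Ordinal.type ((· < ·) : W → W → Prop) = omega1.{u} := Ordinal.type_toType _
  have hWcard : Cardinal.mk W = Cardinal.aleph 1 := Cardinal.mk_ord_toType _
  have : Uncountable W := by
    rw [← Cardinal.aleph0_lt_mk_iff, hWcard]
    exact Cardinal.aleph0_lt_aleph_one
  have hW : ∀ w : W, (Iio w).Countable := by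
    intro w
    have h := Cardinal.mk_Iio_lt w (by rw [hWcard, hWtype]; rfl)
    rw [hWcard, ← Cardinal.succ_aleph0, Order.lt_succ_iff] at h
    exact Cardinal.le_aleph0_iff_set_countable.1 h
  have hr : ∀ t : T, ∃ w : W, Ordinal.typein (α := W) (· < ·) w = treeHeight t := fun t =>
    Ordinal.typein_surj (α := W) (· < ·) (hWtype.symm ▸ hlt t)
  choose r hr using hr
  have hrl : IsLevelMap r := isLevelMap_of_treeHeight hT hr
  have hτ : ∀ w : W, ∃ t, r t = w := by
    intro w
    obtain ⟨t, ht⟩ := hne _ (hWtype ▸ Ordinal.typein_lt_type (α := W) (· < ·) w)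
    exact ⟨t, Ordinal.typein_injective (α := W) (· < ·) (by rw [hr, ht])⟩
  choose τ hτ using hτ
  have hlevW : ∀ w, {t | r t = w}.Countable := by
    intro w
    refine (hlev (Ordinal.typein (α := W) (· < ·) w)).mono ?_
    rintro t rfl
    exact (hr t).symm
  have hTcard : Cardinal.mk T ≤ Cardinal.aleph 1 := by
    refine (Cardinal.mk_le_mk_mul_of_mk_preimage_le (c := Cardinal.aleph0) r fun w =>
      Cardinal.le_aleph0_iff_set_countable.2 (hlevW w)).trans ?_
    rw [hWcard]
    exact Cardinal.mul_le_of_le (Cardinal.aleph0_le_aleph 1) le_rfl (Cardinal.aleph0_le_aleph 1)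
  have hIio : ∀ t : T, (Iio t).Countable := by
    intro t
    refine countable_of_injective_of_countable_image (f := r)
      (fun x hx y hy h => hrl.eq_of_eq hx hy h) ((hW (r t)).mono ?_)
    rintro _ ⟨x, hx, rfl⟩
    exact hrl.strictMono hx
  obtain ⟨g, hg, hg1, hg2⟩ := exists_coherent_coloring hMA hrl hchain hIio hTcard hWcard.le
  have hb := exists_not_finite_branchFn_ne hW hrl hg1 hg2 hτ
  have hc : ∀ d e, d ≤ e → {w | w < d ∧ branchFn r g (τ d) w ≠ branchFn r g (τ e) w}.Finite :=
    fun d e hde => hrl.finite_branchFn_ne hg (hτ d).ge (hde.trans (hτ e).ge)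
  have hρ := ShiftTree.isLevelMap_level hc
  refine ⟨⟨ShiftTree fun d => branchFn r g (τ d), inferInstance⟩,
    ⟨hρ.isTree, ⟨fun α hα => ?_, fun x => ?_⟩, fun α => ?_,
      ShiftTree.noUncountableChain hW hc hb⟩, fun ⟨f, hf⟩ =>
      not_strictMono_shiftTree hW hrl hlevW hg hτ hb f fun _ _ h => hf _ _ h⟩
  · obtain ⟨w, hw⟩ := Ordinal.typein_surj (α := W) (· < ·) (hWtype.symm ▸ hα)
    exact ⟨ShiftTree.base _ w, (hρ.treeHeight_eq _).trans hw⟩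
  · exact (hρ.treeHeight_eq x).trans_lt ((Ordinal.typein_lt_type _ _).trans_eq hWtype)
  · by_cases hα : ∃ w : W, Ordinal.typein (α := W) (· < ·) w = α
    · obtain ⟨w, rfl⟩ := hα
      refine (ShiftTree.countable_level hW w).mono ?_
      intro x hx
      exact Ordinal.typein_injective (α := W) (· < ·) ((hρ.treeHeight_eq x).symm.trans hx)
    · convert countable_empty
      ext x
      simp only [mem_ofPred_eq, mem_empty_iff_false, iff_false]
      exact fun hx => hα ⟨x.level, (hρ.treeHeight_eq x).symm.trans hx⟩
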